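/- Let n ≥ 1 and let P ∈ ℂ[X₁,…,Xₙ] be a nonzero polynomial of total degree d. Then (C(d+n, n))^{-1/2} · M̄(P) ≤ M̃(P) ≤ 2^{n d} · M̄(P), where C(d+n,n) denotes the binomial coefficient. -/

import Mathlib

open MeasureTheory

/-- The Gauss–Weil measure `M̃(P)` of a complex multivariate polynomial: the maximum of the
absolute values of its coefficients (as the supremum of the finite set of those values). -/
noncomputable def gaussWeilMeasure {n : ℕ} (P : MvPolynomial (Fin n) ℂ) : ℝ :=
  sSup ((fun m => ‖MvPolynomial.coeff m P‖) '' (P.support : Set ((Fin n) →₀ ℕ)))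

/-- `log M̄(P) = ∫₀¹⋯∫₀¹ log |P(e^{2πix₁},…,e^{2πixₙ})| dx₁⋯dxₙ`. -/
noncomputable def logMahlerMeasure {n : ℕ} (P : MvPolynomial (Fin n) ℂ) : ℝ :=
  ∫ x in Set.univ.pi fun _ : Fin n => Set.Icc (0 : ℝ) 1,
    Real.log ‖MvPolynomial.eval (fun i => Complex.exp (2 * Real.pi * Complex.I * (x i))) P‖

/-- The Mahler measure `M̄(P)` of a complex multivariate polynomial. -/
noncomputable def mahlerMeasure {n : ℕ} (P : MvPolynomial (Fin n) ℂ) : ℝ :=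
  Real.exp (logMahlerMeasure P)

/-- Uniform probability measure on the unit interval. -/
noncomputable def unitIntervalMeasure : Measure ℝ := volume.restrict (Set.Icc 0 1)

instance : IsProbabilityMeasure unitIntervalMeasure :=
  ⟨by simp [unitIntervalMeasure]⟩

/-- The unit complex number `e^{2πit}`. -/
noncomputable def unitExp (t : ℝ) : ℂ := Complex.exp (2 * Real.pi * Complex.I * t)

@[fun_prop]
lemma continuous_unitExp : Continuous unitExp := by unfold unitExp; fun_prop

lemma unitExp_eq_circleMap (t : ℝ) : unitExp t = circleMap 0 1 (2 * Real.pi * t) := by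
  simp only [unitExp, circleMap]
  push_cast
  ring_nf

lemma norm_unitExp (t : ℝ) : ‖unitExp t‖ = 1 := by
  simp [unitExp_eq_circleMap]

/-- The defect `L - log ‖z‖`, clipped at zero, with value `⊤` at `z = 0`. -/
noncomputable def logDefect (L : ℝ) (z : ℂ) : ENNReal :=
  if z = 0 then ⊤ else ENNReal.ofReal (L - Real.log ‖z‖)

lemma logDefect_zero (L : ℝ) : logDefect L 0 = ⊤ := if_pos rfl

lemma logDefect_of_ne_zero (L : ℝ) {z : ℂ} (hz : z ≠ 0) :
    logDefect L z = ENNReal.ofReal (L - Real.log ‖z‖) := if_neg hz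

lemma measurable_logDefect (L : ℝ) : Measurable (logDefect L) :=
  Measurable.ite (measurableSet_singleton 0) measurable_const (by fun_prop)

lemma integrable_log_norm_eval_unitExp (p : Polynomial ℂ) :
    Integrable (fun t ↦ Real.log ‖p.eval (unitExp t)‖) unitIntervalMeasure := by
  have h := (Polynomial.intervalIntegrable_mahlerMeasure (p := p)).comp_mul_left (c := 2 * Real.pi)
  rw [zero_div, div_self (by positivity), intervalIntegrable_iff_integrableOn_Icc_of_le zero_le_one]
    at h
  simpa only [unitExp_eq_circleMap, unitIntervalMeasure, IntegrableOn] using h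

lemma integral_log_norm_eval_unitExp (p : Polynomial ℂ) :
    ∫ t, Real.log ‖p.eval (unitExp t)‖ ∂unitIntervalMeasure = p.logMahlerMeasure := by
  rw [unitIntervalMeasure, integral_Icc_eq_integral_Ioc,
    ← intervalIntegral.integral_of_le zero_le_one, Polynomial.logMahlerMeasure_def,
    Real.circleAverage_def]
  simp only [unitExp_eq_circleMap]
  rw [intervalIntegral.integral_comp_mul_left
    (fun θ ↦ Real.log ‖p.eval (circleMap 0 1 θ)‖) (by positivity)]
  simp

lemma ae_eval_unitExp_ne_zero {p : Polynomial ℂ} (hp : p ≠ 0) :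
    ∀ᵐ t ∂unitIntervalMeasure, p.eval (unitExp t) ≠ 0 := by
  refine ae_restrict_of_ae ?_
  have hc : {t : ℝ | p.eval (unitExp t) = 0}.Countable := by
    have h := (p.roots.toFinset.countable_toSet.preimage_circleMap 0 one_ne_zero).preimage
      (f := fun t : ℝ ↦ 2 * Real.pi * t) (mul_right_injective₀ (by positivity))
    refine h.mono fun t ht ↦ ?_
    simpa [hp, ← unitExp_eq_circleMap] using ht
  simpa [ae_iff] using hc.measure_zero volume

lemma log_norm_coeff_le_logMahlerMeasure {p : Polynomial ℂ} {d : ℕ} (hd : p.natDegree ≤ d)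
    {k : ℕ} (hk : p.coeff k ≠ 0) :
    Real.log ‖p.coeff k‖ ≤ d * Real.log 2 + p.logMahlerMeasure := by
  have hp : p ≠ 0 := by rintro rfl; simp at hk
  have h : ‖p.coeff k‖ ≤ 2 ^ d * p.mahlerMeasure := by
    refine (p.norm_coeff_le_choose_mul_mahlerMeasure k).trans ?_
    gcongr
    · exact p.mahlerMeasure_nonneg
    · exact_mod_cast (Nat.choose_le_two_pow _ _).trans (Nat.pow_le_pow_right two_pos hd)
  calc Real.log ‖p.coeff k‖ ≤ Real.log (2 ^ d * p.mahlerMeasure) :=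
        Real.log_le_log (norm_pos_iff.2 hk) h
    _ = _ := by
      rw [Real.log_mul (by positivity) (Polynomial.mahlerMeasure_pos_of_ne_zero hp).ne',
        Real.log_pow, Polynomial.logMahlerMeasure_eq_log_MahlerMeasure]

lemma log_norm_eval_le {p : Polynomial ℂ} {L : ℝ}
    (hL : ∀ t, ‖p.eval (unitExp t)‖ ≤ Real.exp L) {t : ℝ} (ht : p.eval (unitExp t) ≠ 0) :
    Real.log ‖p.eval (unitExp t)‖ ≤ L :=
  (Real.log_le_iff_le_exp (norm_pos_iff.2 ht)).2 (hL t)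

lemma norm_coeff_le_exp {p : Polynomial ℂ} {d : ℕ} (hd : p.natDegree ≤ d) {L : ℝ}
    (hL : ∀ t, ‖p.eval (unitExp t)‖ ≤ Real.exp L) (k : ℕ) :
    ‖p.coeff k‖ ≤ Real.exp (L + d * Real.log 2) := by
  by_cases hk : p.coeff k = 0
  · simp [hk, Real.exp_nonneg]
  have hp : p ≠ 0 := by rintro rfl; simp at hk
  rw [← Real.log_le_iff_le_exp (norm_pos_iff.2 hk)]
  have h1 : p.logMahlerMeasure ≤ L := by
    rw [← integral_log_norm_eval_unitExp]
    calc _ ≤ ∫ _, L ∂unitIntervalMeasure :=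
          integral_mono_ae (integrable_log_norm_eval_unitExp p) (integrable_const L)
            ((ae_eval_unitExp_ne_zero hp).mono fun t ht ↦ log_norm_eval_le hL ht)
      _ = L := by simp
  linarith [log_norm_coeff_le_logMahlerMeasure hd hk]

lemma lintegral_logDefect_eval_le {p : Polynomial ℂ} {d : ℕ} (hd : p.natDegree ≤ d) {L : ℝ}
    (hL : ∀ t, ‖p.eval (unitExp t)‖ ≤ Real.exp L) (k : ℕ) :
    ∫⁻ t, logDefect L (p.eval (unitExp t)) ∂unitIntervalMeasure ≤
      logDefect (L + d * Real.log 2) (p.coeff k) := by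
  by_cases hk : p.coeff k = 0
  · simp [hk, logDefect_zero]
  have hp : p ≠ 0 := by rintro rfl; simp at hk
  have hae := ae_eval_unitExp_ne_zero hp
  have hint := (integrable_const L).sub (integrable_log_norm_eval_unitExp p)
  calc _ = ∫⁻ t, ENNReal.ofReal (L - Real.log ‖p.eval (unitExp t)‖) ∂unitIntervalMeasure :=
        lintegral_congr_ae (hae.mono fun t ht ↦ logDefect_of_ne_zero L ht)
    _ = ENNReal.ofReal (∫ t, (L - Real.log ‖p.eval (unitExp t)‖) ∂unitIntervalMeasure) :=
        (ofReal_integral_eq_lintegral_ofReal hint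
          (hae.mono fun t ht ↦ sub_nonneg.2 (log_norm_eval_le hL ht))).symm
    _ ≤ _ := by
        rw [logDefect_of_ne_zero _ hk, integral_sub (integrable_const L)
          (integrable_log_norm_eval_unitExp p), integral_log_norm_eval_unitExp]
        apply ENNReal.ofReal_le_ofReal
        simp only [integral_const, probReal_univ, one_smul]
        linarith [log_norm_coeff_le_logMahlerMeasure hd hk]

/-- The product of uniform measures on `[0, 1]ⁿ`. -/
noncomputable abbrev unitCubeMeasure (n : ℕ) : Measure (Fin n → ℝ) :=
  Measure.pi fun _ ↦ unitIntervalMeasure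

lemma continuous_eval_unitExp {n : ℕ} (P : MvPolynomial (Fin n) ℂ) :
    Continuous fun x : Fin n → ℝ ↦ MvPolynomial.eval (fun i ↦ unitExp (x i)) P :=
  P.continuous_eval.comp (by fun_prop)

lemma eval_unitExp_cons {n : ℕ} (P : MvPolynomial (Fin (n + 1)) ℂ) (t : ℝ) (y : Fin n → ℝ) :
    MvPolynomial.eval (fun i ↦ unitExp ((Fin.cons t y : Fin (n + 1) → ℝ) i)) P =
      ((MvPolynomial.finSuccEquiv ℂ n P).map
        (MvPolynomial.eval fun i ↦ unitExp (y i))).eval (unitExp t) := by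
  rw [← MvPolynomial.eval_eq_eval_mv_eval']
  congr 2
  funext i
  cases i using Fin.cases <;> simp

theorem lintegral_logDefect_mvPolynomial_eval_le {n : ℕ} {P : MvPolynomial (Fin n) ℂ} {d : ℕ}
    (hd : ∀ i, P.degreeOf i ≤ d) {L : ℝ}
    (hL : ∀ x : Fin n → ℝ, ‖MvPolynomial.eval (fun i ↦ unitExp (x i)) P‖ ≤ Real.exp L)
    (m : Fin n →₀ ℕ) :
    ∫⁻ x, logDefect L (MvPolynomial.eval (fun i ↦ unitExp (x i)) P) ∂unitCubeMeasure n ≤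
      logDefect (L + n * (d * Real.log 2)) (P.coeff m) := by
  induction n generalizing L with
  | zero =>
    obtain ⟨c, rfl⟩ := MvPolynomial.C_surjective (Fin 0) P
    simp [Subsingleton.elim m 0]
  | succ n ih =>
    set Q := MvPolynomial.finSuccEquiv ℂ n P with hQ
    have hdeg (y : Fin n → ℝ) :
        (Q.map (MvPolynomial.eval fun i ↦ unitExp (y i))).natDegree ≤ d :=
      (Polynomial.natDegree_map_le).trans ((MvPolynomial.natDegree_finSuccEquiv P).trans_le (hd 0))
    have hLy (y : Fin n → ℝ) (t : ℝ) :
        ‖(Q.map (MvPolynomial.eval fun i ↦ unitExp (y i))).eval (unitExp t)‖ ≤ Real.exp L := by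
      rw [hQ, ← eval_unitExp_cons]
      exact hL _
    have hmp := (measurePreserving_piFinSuccAbove
      (fun _ : Fin (n + 1) ↦ unitIntervalMeasure) 0).symm
    have hmeas : Measurable fun x : Fin (n + 1) → ℝ ↦
        logDefect L (MvPolynomial.eval (fun i ↦ unitExp (x i)) P) :=
      (measurable_logDefect L).comp (continuous_eval_unitExp P).measurable
    rw [← hmp.lintegral_comp hmeas,
      lintegral_prod_symm' (fun z ↦ logDefect L (MvPolynomial.eval (fun i ↦ unitExp
        ((MeasurableEquiv.piFinSuccAbove (fun _ ↦ ℝ) 0).symm z i)) P))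
        (hmeas.comp (MeasurableEquiv.measurable _))]
    calc _ = ∫⁻ y, ∫⁻ t, logDefect L
            ((Q.map (MvPolynomial.eval fun i ↦ unitExp (y i))).eval (unitExp t))
            ∂unitIntervalMeasure ∂unitCubeMeasure n := by
          simp [hQ, ← eval_unitExp_cons, MeasurableEquiv.piFinSuccAbove_symm_apply]
      _ ≤ ∫⁻ y, logDefect (L + d * Real.log 2)
            (MvPolynomial.eval (fun i ↦ unitExp (y i)) (Q.coeff (m 0))) ∂unitCubeMeasure n := by
          refine lintegral_mono fun y ↦ ?_
          simpa using lintegral_logDefect_eval_le (hdeg y) (hLy y) (m 0)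
      _ ≤ logDefect (L + d * Real.log 2 + n * (d * Real.log 2))
            ((Q.coeff (m 0)).coeff m.tail) := by
          refine ih (fun i ↦ (MvPolynomial.degreeOf_coeff_finSuccEquiv P i (m 0)).trans (hd i.succ))
            (fun y ↦ ?_) m.tail
          simpa using norm_coeff_le_exp (hdeg y) (hLy y) (m 0)
      _ = _ := by
          rw [hQ, MvPolynomial.finSuccEquiv_coeff_coeff, Finsupp.cons_tail]
          push_cast
          ring_nf

lemma integral_unitExp_pow_mul_conj_pow (a b : ℕ) :
    ∫ t, unitExp t ^ a * (starRingEnd ℂ) (unitExp t ^ b) ∂unitIntervalMeasure =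
      if a = b then 1 else 0 := by
  have h (t : ℝ) : unitExp t ^ a * (starRingEnd ℂ) (unitExp t ^ b) =
      Complex.exp ((a - b : ℂ) * (2 * Real.pi * Complex.I) * t) := by
    simp only [unitExp, ← Complex.exp_conj, ← Complex.exp_nat_mul, ← Complex.exp_add]
    congr 1
    simp only [map_mul, Complex.conj_I, Complex.conj_ofReal, map_ofNat, map_natCast]
    ring
  simp only [h]
  split_ifs with hab
  · simp [hab]
  · rw [unitIntervalMeasure, integral_Icc_eq_integral_Ioc,
      ← intervalIntegral.integral_of_le zero_le_one, integral_exp_mul_complex]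
    · have h1 : Complex.exp ((a - b : ℂ) * (2 * Real.pi * Complex.I)) = 1 := by
        simpa using Complex.exp_int_mul_two_pi_mul_I (a - b : ℤ)
      simp [h1]
    · simpa [sub_eq_zero] using hab

lemma integrable_unitCubeMeasure_of_continuous_of_bound {n : ℕ} {E : Type*}
    [NormedAddCommGroup E] {f : (Fin n → ℝ) → E} (hf : Continuous f) {C : ℝ}
    (hC : ∀ x, ‖f x‖ ≤ C) : Integrable f (unitCubeMeasure n) :=
  .of_bound hf.aestronglyMeasurable C (.of_forall hC)

/-- Parseval's identity for polynomials on the torus. -/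
theorem integral_norm_sq_eval_unitExp {n : ℕ} (P : MvPolynomial (Fin n) ℂ) :
    ∫ x, ‖MvPolynomial.eval (fun i ↦ unitExp (x i)) P‖ ^ 2 ∂unitCubeMeasure n =
      ∑ m ∈ P.support, ‖P.coeff m‖ ^ 2 := by
  have expand (x : Fin n → ℝ) :
      ((‖MvPolynomial.eval (fun i ↦ unitExp (x i)) P‖ ^ 2 : ℝ) : ℂ) =
        ∑ m ∈ P.support, ∑ l ∈ P.support, P.coeff m * (starRingEnd ℂ) (P.coeff l) *
          ∏ i, (unitExp (x i) ^ m i * (starRingEnd ℂ) (unitExp (x i) ^ l i)) := by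
    rw [Complex.ofReal_pow, ← Complex.mul_conj', MvPolynomial.eval_eq', map_sum,
      Finset.sum_mul_sum]
    refine Finset.sum_congr rfl fun m _ ↦ Finset.sum_congr rfl fun l _ ↦ ?_
    rw [map_mul, map_prod, Finset.prod_mul_distrib]
    ring
  have hint (m l : Fin n →₀ ℕ) : Integrable (fun x : Fin n → ℝ ↦
      P.coeff m * (starRingEnd ℂ) (P.coeff l) *
        ∏ i, (unitExp (x i) ^ m i * (starRingEnd ℂ) (unitExp (x i) ^ l i)))
      (unitCubeMeasure n) := by
    refine integrable_unitCubeMeasure_of_continuous_of_bound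
      (C := ‖P.coeff m * (starRingEnd ℂ) (P.coeff l)‖) ?_ fun x ↦ ?_
    · have := Complex.continuous_conj
      fun_prop
    · simp [norm_unitExp]
  have orth (m l : Fin n →₀ ℕ) :
      ∫ x : Fin n → ℝ, ∏ i, (unitExp (x i) ^ m i * (starRingEnd ℂ) (unitExp (x i) ^ l i))
        ∂unitCubeMeasure n = if m = l then 1 else 0 := by
    rw [integral_fintype_prod_eq_prod
      (fun i t ↦ unitExp t ^ m i * (starRingEnd ℂ) (unitExp t ^ l i))]
    simp only [integral_unitExp_pow_mul_conj_pow, Finset.prod_ite_zero, Finset.prod_const_one,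
      Finset.mem_univ, true_imp_iff, DFunLike.ext_iff]
  apply Complex.ofReal_injective
  rw [← integral_complex_ofReal]
  simp only [expand]
  rw [integral_finsetSum _ fun m _ ↦ integrable_finsetSum _ fun l _ ↦ hint m l,
    Complex.ofReal_sum]
  refine Finset.sum_congr rfl fun m hm ↦ ?_
  rw [integral_finsetSum _ fun l _ ↦ hint m l]
  simp only [integral_const_mul, orth, mul_ite, mul_one, mul_zero, Finset.sum_ite_eq, if_pos hm]
  rw [Complex.mul_conj', Complex.ofReal_pow]

lemma card_support_le_choose {n : ℕ} (P : MvPolynomial (Fin n) ℂ) :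
    P.support.card ≤ (P.totalDegree + n).choose n := by
  have h := Finset.card_le_card_of_injOn (s := P.support)
    (t := (Finset.univ : Finset (Fin (n + 1))).finsuppAntidiag P.totalDegree)
    (fun m ↦ m.cons (P.totalDegree - m.sum fun _ e ↦ e))
    (fun m hm ↦ ?_) (fun m _ l _ hml ↦ ?_)
  · rw [Finset.card_finsuppAntidiag_nat_eq_choose, Finset.card_univ, Fintype.card_fin,
      show n + 1 + P.totalDegree - 1 = P.totalDegree + n by lia] at h
    rwa [Nat.choose_symm_add] at h
  · have hle := MvPolynomial.le_totalDegree hm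
    rw [Finsupp.sum_fintype _ _ (by simp)] at hle
    simp [Fin.sum_univ_succ, Finsupp.sum_fintype]
    lia
  · simpa using congrArg Finsupp.tail hml

lemma norm_coeff_le_gaussWeilMeasure {n : ℕ} {P : MvPolynomial (Fin n) ℂ} {m : Fin n →₀ ℕ}
    (hm : m ∈ P.support) : ‖P.coeff m‖ ≤ gaussWeilMeasure P :=
  le_csSup (P.support.finite_toSet.image _).bddAbove ⟨m, hm, rfl⟩

lemma logMahlerMeasure_eq_integral {n : ℕ} (P : MvPolynomial (Fin n) ℂ) :
    logMahlerMeasure P =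
      ∫ x, Real.log ‖MvPolynomial.eval (fun i ↦ unitExp (x i)) P‖ ∂unitCubeMeasure n := by
  rw [logMahlerMeasure, volume_pi, Measure.restrict_pi_pi]
  rfl

lemma exists_norm_eval_unitExp_le {n : ℕ} (P : MvPolynomial (Fin n) ℂ) :
    ∃ L : ℝ, ∀ x : Fin n → ℝ, ‖MvPolynomial.eval (fun i ↦ unitExp (x i)) P‖ ≤ Real.exp L := by
  refine ⟨∑ m ∈ P.support, ‖P.coeff m‖, fun x ↦ ?_⟩
  calc _ ≤ ∑ m ∈ P.support, ‖P.coeff m‖ := by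
        rw [MvPolynomial.eval_eq']
        refine (norm_sum_le _ _).trans_eq (Finset.sum_congr rfl fun m _ ↦ ?_)
        simp [norm_unitExp]
    _ ≤ _ := by linarith [Real.add_one_le_exp (∑ m ∈ P.support, ‖P.coeff m‖)]

lemma ae_mvPolynomial_eval_unitExp_ne_zero {n : ℕ} {P : MvPolynomial (Fin n) ℂ} (hP : P ≠ 0) :
    ∀ᵐ x ∂unitCubeMeasure n, MvPolynomial.eval (fun i ↦ unitExp (x i)) P ≠ 0 := by
  obtain ⟨L, hL⟩ := exists_norm_eval_unitExp_le P
  obtain ⟨m, hm⟩ := MvPolynomial.ne_zero_iff.1 hP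
  have h := lintegral_logDefect_mvPolynomial_eval_le (P.degreeOf_le_totalDegree) hL m
  rw [logDefect_of_ne_zero _ hm] at h
  filter_upwards [ae_lt_top
    ((measurable_logDefect L).comp (continuous_eval_unitExp P).measurable)
    (h.trans_lt ENNReal.ofReal_lt_top).ne] with x hx h0
  simp [h0, logDefect_zero] at hx

lemma lintegral_ofReal_sub_log_norm_eval_le {n : ℕ} {P : MvPolynomial (Fin n) ℂ} {L : ℝ}
    (hL : ∀ x : Fin n → ℝ, ‖MvPolynomial.eval (fun i ↦ unitExp (x i)) P‖ ≤ Real.exp L)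
    {m : Fin n →₀ ℕ} (hm : P.coeff m ≠ 0) :
    ∫⁻ x, ENNReal.ofReal (L - Real.log ‖MvPolynomial.eval (fun i ↦ unitExp (x i)) P‖)
      ∂unitCubeMeasure n ≤
      ENNReal.ofReal (L + n * (P.totalDegree * Real.log 2) - Real.log ‖P.coeff m‖) := by
  have hP : P ≠ 0 := by rintro rfl; simp at hm
  have h := lintegral_logDefect_mvPolynomial_eval_le (P.degreeOf_le_totalDegree) hL m
  rw [logDefect_of_ne_zero _ hm] at h
  refine h.trans' (lintegral_congr_ae ?_).le
  filter_upwards [ae_mvPolynomial_eval_unitExp_ne_zero hP] with x hx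
  rw [logDefect_of_ne_zero _ hx]

lemma measurable_log_norm_eval_unitExp {n : ℕ} (P : MvPolynomial (Fin n) ℂ) :
    Measurable fun x : Fin n → ℝ ↦
      Real.log ‖MvPolynomial.eval (fun i ↦ unitExp (x i)) P‖ :=
  Real.measurable_log.comp (continuous_eval_unitExp P).norm.measurable

lemma ae_log_norm_eval_unitExp_le {n : ℕ} {P : MvPolynomial (Fin n) ℂ} (hP : P ≠ 0) {L : ℝ}
    (hL : ∀ x : Fin n → ℝ, ‖MvPolynomial.eval (fun i ↦ unitExp (x i)) P‖ ≤ Real.exp L) :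
    ∀ᵐ x ∂unitCubeMeasure n,
      0 ≤ L - Real.log ‖MvPolynomial.eval (fun i ↦ unitExp (x i)) P‖ :=
  (ae_mvPolynomial_eval_unitExp_ne_zero hP).mono fun x hx ↦
    sub_nonneg.2 ((Real.log_le_iff_le_exp (norm_pos_iff.2 hx)).2 (hL x))

theorem integrable_log_norm_mvPolynomial_eval_unitExp {n : ℕ} {P : MvPolynomial (Fin n) ℂ}
    (hP : P ≠ 0) : Integrable
      (fun x ↦ Real.log ‖MvPolynomial.eval (fun i ↦ unitExp (x i)) P‖) (unitCubeMeasure n) := by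
  obtain ⟨L, hL⟩ := exists_norm_eval_unitExp_le P
  obtain ⟨m, hm⟩ := MvPolynomial.ne_zero_iff.1 hP
  have h := lintegral_ofReal_sub_log_norm_eval_le hL hm
  have hsub : Integrable
      (fun x ↦ L - Real.log ‖MvPolynomial.eval (fun i ↦ unitExp (x i)) P‖)
      (unitCubeMeasure n) :=
    (lintegral_ofReal_ne_top_iff_integrable
      (measurable_const.sub (measurable_log_norm_eval_unitExp P)).aestronglyMeasurable
      (ae_log_norm_eval_unitExp_le hP hL)).1 (h.trans_lt ENNReal.ofReal_lt_top).ne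
  simpa only [Pi.sub_def, sub_sub_cancel] using (integrable_const L).sub hsub

theorem norm_coeff_le_two_pow_mul_mahlerMeasure {n : ℕ} {P : MvPolynomial (Fin n) ℂ}
    {m : Fin n →₀ ℕ} (hm : P.coeff m ≠ 0) :
    ‖P.coeff m‖ ≤ 2 ^ (n * P.totalDegree) * mahlerMeasure P := by
  have hP : P ≠ 0 := by rintro rfl; simp at hm
  obtain ⟨L, hcL, hL⟩ : ∃ L : ℝ, Real.log ‖P.coeff m‖ ≤ L ∧
      ∀ x : Fin n → ℝ, ‖MvPolynomial.eval (fun i ↦ unitExp (x i)) P‖ ≤ Real.exp L := by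
    obtain ⟨L, hL⟩ := exists_norm_eval_unitExp_le P
    exact ⟨max L (Real.log ‖P.coeff m‖), le_max_right _ _,
      fun x ↦ (hL x).trans (Real.exp_le_exp.2 (le_max_left _ _))⟩
  have hint := integrable_log_norm_mvPolynomial_eval_unitExp hP
  have h := lintegral_ofReal_sub_log_norm_eval_le hL hm
  have hsub : Integrable
      (fun x ↦ L - Real.log ‖MvPolynomial.eval (fun i ↦ unitExp (x i)) P‖)
      (unitCubeMeasure n) := (integrable_const L).sub hint
  have hlog2 : 0 ≤ n * (P.totalDegree * Real.log 2) := by positivity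
  rw [← ofReal_integral_eq_lintegral_ofReal hsub (ae_log_norm_eval_unitExp_le hP hL),
    integral_sub (integrable_const L) hint, ← logMahlerMeasure_eq_integral,
    ENNReal.ofReal_le_ofReal_iff (by linarith)] at h
  simp only [integral_const, probReal_univ, one_smul] at h
  rw [mahlerMeasure, ← Real.log_le_log_iff (norm_pos_iff.2 hm)
      (mul_pos (by positivity) (Real.exp_pos _)),
    Real.log_mul (by positivity) (Real.exp_pos _).ne', Real.log_exp, Real.log_pow]
  push_cast
  linarith

theorem mahlerMeasure_sq_le {n : ℕ} {P : MvPolynomial (Fin n) ℂ} (hP : P ≠ 0) :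
    mahlerMeasure P ^ 2 ≤ ∑ m ∈ P.support, ‖P.coeff m‖ ^ 2 := by
  obtain ⟨L, hL⟩ := exists_norm_eval_unitExp_le P
  have hint := (integrable_log_norm_mvPolynomial_eval_unitExp hP).const_mul 2
  have hexp : (fun x ↦ Real.exp (2 * Real.log ‖MvPolynomial.eval (fun i ↦ unitExp (x i)) P‖))
      =ᵐ[unitCubeMeasure n] fun x ↦ ‖MvPolynomial.eval (fun i ↦ unitExp (x i)) P‖ ^ 2 := by
    filter_upwards [ae_mvPolynomial_eval_unitExp_ne_zero hP] with x hx
    rw [two_mul, Real.exp_add, Real.exp_log (norm_pos_iff.2 hx), sq]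
  have hsq : Integrable (fun x ↦ ‖MvPolynomial.eval (fun i ↦ unitExp (x i)) P‖ ^ 2)
      (unitCubeMeasure n) := by
    refine integrable_unitCubeMeasure_of_continuous_of_bound (C := Real.exp L ^ 2)
      ((continuous_eval_unitExp P).norm.pow 2) fun x ↦ ?_
    rw [norm_pow, norm_norm]
    exact pow_le_pow_left₀ (norm_nonneg _) (hL x) 2
  have h := convexOn_exp.map_integral_le Real.continuous_exp.continuousOn isClosed_univ
    (.of_forall fun _ ↦ Set.mem_univ _) hint (hsq.congr hexp.symm)
  rwa [integral_congr_ae hexp, integral_norm_sq_eval_unitExp, integral_const_mul,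
    ← logMahlerMeasure_eq_integral, two_mul, Real.exp_add, ← sq] at h

/-- For a nonzero `P ∈ ℂ[X₁,…,Xₙ]` of total degree `d`:
`C(d+n,n)^{-1/2} · M̄(P) ≤ M̃(P) ≤ 2^{nd} · M̄(P)`. -/
theorem gaussWeil_mahler_comparison (n : ℕ) (hn : 1 ≤ n) (d : ℕ)
    (P : MvPolynomial (Fin n) ℂ) (hP : P ≠ 0) (hd : P.totalDegree = d) :
    (((d + n).choose n : ℝ) ^ (-(1 : ℝ) / 2)) * mahlerMeasure P ≤ gaussWeilMeasure P ∧
    gaussWeilMeasure P ≤ 2 ^ (n * d) * mahlerMeasure P := by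
  subst hd
  constructor
  · have hG : 0 ≤ gaussWeilMeasure P :=
      Real.sSup_nonneg (by rintro _ ⟨m, -, rfl⟩; exact norm_nonneg _)
    have hC : (0 : ℝ) < (P.totalDegree + n).choose n := by
      exact_mod_cast Nat.choose_pos (Nat.le_add_left _ _)
    have h : mahlerMeasure P ^ 2 ≤ (P.totalDegree + n).choose n * gaussWeilMeasure P ^ 2 :=
      calc _ ≤ ∑ m ∈ P.support, ‖P.coeff m‖ ^ 2 := mahlerMeasure_sq_le hP
        _ ≤ ∑ m ∈ P.support, gaussWeilMeasure P ^ 2 :=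
            Finset.sum_le_sum fun m hm ↦
              pow_le_pow_left₀ (norm_nonneg _) (norm_coeff_le_gaussWeilMeasure hm) 2
        _ ≤ _ := by
            rw [Finset.sum_const, nsmul_eq_mul]
            gcongr
            exact card_support_le_choose P
    rw [neg_div, Real.rpow_neg hC.le, ← Real.sqrt_eq_rpow, inv_mul_le_iff₀ (Real.sqrt_pos.2 hC)]
    refine le_of_sq_le_sq ?_ (by positivity)
    rwa [mul_pow, Real.sq_sqrt hC.le]
  · refine csSup_le ((Finset.coe_nonempty.2 (MvPolynomial.support_nonempty.2 hP)).image _) ?_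
    rintro _ ⟨m, hm, rfl⟩
    exact norm_coeff_le_two_pow_mul_mahlerMeasure (MvPolynomial.mem_support_iff.1 hm)
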